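/- Every normal subgroup of SL(2, F₇) is either the trivial subgroup, the center {±1} (which has order 2), or the whole group. In particular, the only nontrivial proper normal subgroup of SL(2, F₇) is {1, -1}. -/

import Mathlib

local instance : Fact (Even (Fintype.card (Fin 2))) := ⟨⟨1, by norm_num⟩⟩

namespace Subgroup

variable {G : Type*} [Group G]

open scoped commutatorElement in
/-- If a normal subgroup together with the center generates the whole group, then it contains the
commutator subgroup. -/
theorem commutator_le_of_sup_center_eq_top {N : Subgroup G} [N.Normal]
    (h : N ⊔ center G = ⊤) : _root_.commutator G ≤ N := by
  rw [_root_.commutator_def, commutator_le]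
  intro g _ x _
  obtain ⟨n, hn, z, hz, rfl⟩ := mem_sup_of_normal_left.1 (h ▸ mem_top x : x ∈ N ⊔ center G)
  have hzg : z * g⁻¹ * z⁻¹ = g⁻¹ := by
    rw [← mem_center_iff.1 hz g⁻¹, mul_inv_cancel_right]
  have key : ⁅g, n * z⁆ = g * n * g⁻¹ * n⁻¹ := by
    calc ⁅g, n * z⁆ = g * n * (z * g⁻¹ * z⁻¹) * n⁻¹ := by rw [commutatorElement_def]; group
      _ = g * n * g⁻¹ * n⁻¹ := by rw [hzg]
  rw [key]
  exact N.mul_mem (‹N.Normal›.conj_mem n hn g) (N.inv_mem hn)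

/-- A normal subgroup of a perfect group that is simple modulo its center is central or the whole
group. -/
theorem Normal.le_center_or_eq_top [Group.IsPerfect G] [IsSimpleGroup (G ⧸ center G)]
    {N : Subgroup G} (hN : N.Normal) : N ≤ center G ∨ N = ⊤ := by
  have hmap : (N.map (QuotientGroup.mk' (center G))).Normal :=
    hN.map _ (QuotientGroup.mk'_surjective _)
  refine hmap.eq_bot_or_eq_top.imp (fun h ↦ ?_) fun h ↦ ?_
  · simpa using (map_eq_bot_iff N).1 h
  · have hsup : N ⊔ center G = ⊤ := by
      have := congrArg (Subgroup.comap (QuotientGroup.mk' (center G))) h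
      rwa [comap_map_eq, QuotientGroup.ker_mk', comap_top] at this
    rw [eq_top_iff, ← Group.IsPerfect.commutator_eq_top (G := G)]
    exact commutator_le_of_sup_center_eq_top hsup

end Subgroup

open scoped MatrixGroups in
/-- The center of `SL(2, R)` over a domain consists of `1` and `-1`. -/
theorem Matrix.SpecialLinearGroup.mem_center_fin_two_iff {R : Type*} [CommRing R] [IsDomain R]
    {x : SL(2, R)} : x ∈ Subgroup.center SL(2, R) ↔ x = 1 ∨ x = -1 := by
  rw [mem_center_iff]
  constructor
  · rintro ⟨r, hr, hx⟩
    rw [Fintype.card_fin, sq_eq_one_iff] at hr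
    rcases hr with rfl | rfl
    · exact Or.inl (Subtype.ext (by simp [← hx]))
    · exact Or.inr (Subtype.ext (by simp [← hx, ← diagonal_one, ← diagonal_neg]))
  · rintro (rfl | rfl)
    · exact ⟨1, by simp, by simp⟩
    · exact ⟨-1, by simp, by simp [← diagonal_one, ← diagonal_neg]⟩

theorem stmt_2 :
    (∀ x : Matrix.SpecialLinearGroup (Fin 2) (ZMod 7),
        x ∈ Subgroup.center (Matrix.SpecialLinearGroup (Fin 2) (ZMod 7)) ↔ x = 1 ∨ x = -1) ∧
    Nat.card (Subgroup.center (Matrix.SpecialLinearGroup (Fin 2) (ZMod 7))) = 2 ∧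
    ∀ N : Subgroup (Matrix.SpecialLinearGroup (Fin 2) (ZMod 7)), N.Normal →
      N = ⊥ ∨ N = Subgroup.center (Matrix.SpecialLinearGroup (Fin 2) (ZMod 7)) ∨ N = ⊤ := by
  have h2 : (2 : ZMod 7) ≠ 0 := by decide
  have h2sq : (2 : ZMod 7) ^ 2 ≠ 1 := by decide
  have : Fact (Nat.Prime 7) := ⟨by norm_num⟩
  have hcenter (x : Matrix.SpecialLinearGroup (Fin 2) (ZMod 7)) :
      x ∈ Subgroup.center (Matrix.SpecialLinearGroup (Fin 2) (ZMod 7)) ↔ x = 1 ∨ x = -1 :=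
    Matrix.SpecialLinearGroup.mem_center_fin_two_iff
  have hcard : Nat.card (Subgroup.center (Matrix.SpecialLinearGroup (Fin 2) (ZMod 7))) = 2 := by
    have hset : (Subgroup.center (Matrix.SpecialLinearGroup (Fin 2) (ZMod 7)) :
        Set (Matrix.SpecialLinearGroup (Fin 2) (ZMod 7))) =
        {1, -1} := Set.ext hcenter
    rw [← SetLike.coe_sort_coe, hset, Nat.card_coe_set_eq, Set.ncard_pair (by decide)]
  have : Group.IsPerfect (Matrix.SpecialLinearGroup (Fin 2) (ZMod 7)) :=
    ⟨Matrix.SL2.commutator_eq_top h2 h2sq⟩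
  have : IsSimpleGroup (Matrix.ProjectiveSpecialLinearGroup (Fin 2) (ZMod 7)) :=
    Matrix.ProjectiveSpecialLinearGroup.rank_two_simple (by simp)
  refine ⟨hcenter, hcard, fun N hN ↦ ?_⟩
  rcases hN.le_center_or_eq_top with hle | htop
  · have : Fact (Nat.card (Subgroup.center (Matrix.SpecialLinearGroup (Fin 2) (ZMod 7)))).Prime :=
      ⟨by rw [hcard]; exact Nat.prime_two⟩
    rcases (N.subgroupOf (Subgroup.center _)).eq_bot_or_eq_top_of_prime_card with h | h
    · exact Or.inl ((Subgroup.subgroupOf_eq_bot.1 h).eq_bot_of_le hle)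
    · exact Or.inr (Or.inl (le_antisymm hle (Subgroup.subgroupOf_eq_top.1 h)))
  · exact Or.inr (Or.inr htop)
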